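/- For a semigroup S, the following are equivalent: (i) (∀ a b)(∃ x): a = a*b*x*b*a; (ii) (∀ a b)(∃ x): a = a*b*x*a; (iii) (∀ a b)(∃ x): a = a*x*b*a; (iv) S is completely simple (completely regular and any two elements J-related). -/

import Mathlib

theorem aux_ii {S : Type*} [Semigroup S] (H : ∀ a b : S, ∃ x : S, a = a * b * x * a) (a : S) :
    (∃ u, a = a * a * u) ∧ ∃ v, a = v * a * a := by
  obtain ⟨x, hx⟩ := H a a
  obtain ⟨z, hz⟩ := H (a * a) (a * a)
  refine ⟨⟨x * a, by rw [← mul_assoc]; exact hx⟩, ?_⟩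
  obtain ⟨e, he⟩ : ∃ e, e = a * x * a := ⟨_, rfl⟩
  obtain ⟨h, hh⟩ : ∃ h, h = a * a * z * (a * a) := ⟨_, rfl⟩
  have ae : a * e = a := by rw [he]; simpa [mul_assoc] using hx.symm
  have hhh : h * h = h := by
    have : a * a * h = a * a := by rw [hh]; simpa [mul_assoc] using hz.symm
    calc h * h = a * a * z * (a * a * h) := by simp only [hh, mul_assoc]
      _ = h := by rw [this, hh]
  have hee : h * e = h := by
    calc h * e = a * a * z * (a * (a * e)) := by simp only [hh, mul_assoc]
      _ = h := by rw [ae, hh]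
  have ee : e * e = e := by
    calc e * e = a * x * (a * e) := by simp only [he, mul_assoc]
      _ = e := by rw [ae, he]
  obtain ⟨w, hw⟩ := H e (e * h)
  have hw' : e = e * h * w * e := by
    rw [← mul_assoc, ee] at hw; exact hw
  have e1 : e * h * e = e := by
    calc e * h * e = e * h * (e * h * w * e) := by rw [← hw']
      _ = e * (h * e) * h * w * e := by simp only [mul_assoc]
      _ = e * (h * h) * w * e := by rw [hee]; simp only [mul_assoc]
      _ = e := by rw [hhh, ← hw']
  have e2 : e * h = e := by rw [mul_assoc, hee] at e1; exact e1
  refine ⟨a * e * (a * a * z), ?_⟩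
  calc a = a * (e * h) := by rw [e2, ae]
    _ = _ := by simp only [hh, mul_assoc]

theorem aux_iii {S : Type*} [Semigroup S] (H : ∀ a b : S, ∃ x : S, a = a * x * b * a) (a : S) :
    (∃ u, a = a * a * u) ∧ ∃ v, a = v * a * a := by
  have := aux_ii (S := Sᵐᵒᵖ) (fun a b => by
    obtain ⟨x, hx⟩ := H a.unop b.unop
    refine ⟨MulOpposite.op x, MulOpposite.unop_injective ?_⟩
    simpa [mul_assoc] using hx) (MulOpposite.op a)
  obtain ⟨⟨u, hu⟩, v, hv⟩ := this
  refine ⟨⟨v.unop, ?_⟩, u.unop, ?_⟩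
  · have := congrArg MulOpposite.unop hv
    simpa [mul_assoc] using this
  · have := congrArg MulOpposite.unop hu
    simpa [mul_assoc] using this

theorem aux_cr {S : Type*} [Semigroup S] (a : S)
    (H : (∃ u, a = a * a * u) ∧ ∃ v, a = v * a * a) : ∃ x, a = a * x * a ∧ a * x = x * a := by
  obtain ⟨⟨u, hu⟩, v, hv⟩ := H
  have h1 : v * a = a * u := by
    calc v * a = v * (a * a * u) := by rw [← hu]
      _ = v * a * a * u := by simp only [mul_assoc]
      _ = a * u := by rw [← hv]
  have h2 : a * (v * a * u) = a * u := by
    calc a * (v * a * u) = a * a * u * u := by rw [h1]; simp only [mul_assoc]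
      _ = a * u := by rw [← hu]
  have h3 : v * a * u * a = v * a := by
    calc v * a * u * a = v * (a * u) * a := by simp only [mul_assoc]
      _ = v * (v * a * a) := by rw [← h1]; simp only [mul_assoc]
      _ = v * a := by rw [← hv]
  exact ⟨v * a * u, by rw [h2, ← h1]; exact hv, by rw [h2, h3, h1]⟩

theorem aux_i {S : Type*} [Semigroup S]
    (R : ∀ a : S, ∃ x : S, a = a * x * a ∧ a * x = x * a)
    (J : ∀ a b : S, a = b ∨ (∃ s : S, a = s * b) ∨ (∃ t : S, a = b * t) ∨ ∃ s t : S, a = s * b * t)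
    (a b : S) : ∃ x : S, a = a * b * x * b * a := by
  have J' : ∀ a b : S, ∃ s t : S, a = s * b * t := by
    intro a b
    obtain ⟨w, hw, -⟩ := R b
    have hb : b = (b * w) * b * (w * b) := by
      calc b = b * w * b := hw
        _ = b * w * (b * w * b) := by rw [← hw]; exact hw
        _ = _ := by simp only [mul_assoc]
    rcases J a b with h | ⟨s, h⟩ | ⟨t, h⟩ | h
    · exact ⟨_, _, h.trans hb⟩
    · refine ⟨s * (b * w), w * b, ?_⟩
      rw [h]; conv_lhs => rw [hb]
      simp only [mul_assoc]
    · refine ⟨b * w, w * b * t, ?_⟩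
      rw [h]; conv_lhs => rw [hb]
      simp only [mul_assoc]
    · exact h
  have r : ∃ p, a = a * b * p := by
    obtain ⟨s, t, h⟩ := J' a (a * b)
    obtain ⟨c, hc, hc'⟩ := R (b * t)
    refine ⟨t * c, ?_⟩
    have h' : a = s * a * (b * t) := by simpa only [mul_assoc] using h
    calc a = s * a * (b * t) := h'
      _ = s * a * (b * t * c * (b * t)) := by rw [← hc]
      _ = s * a * (b * t * (b * t * c)) := by rw [mul_assoc (b * t) c, ← hc']
      _ = s * a * (b * t) * (b * t * c) := by simp only [mul_assoc]
      _ = a * (b * t * c) := by rw [← h']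
      _ = _ := by simp only [mul_assoc]
  have l : ∃ q, a = q * b * a := by
    obtain ⟨s, t, h⟩ := J' a (b * a)
    obtain ⟨c, hc, hc'⟩ := R (s * b)
    refine ⟨c * s, ?_⟩
    have h' : a = s * b * a * t := by simpa only [mul_assoc] using h
    calc a = s * b * a * t := h'
      _ = (s * b * c * (s * b)) * a * t := by rw [← hc]
      _ = c * (s * b) * (s * b * a * t) := by rw [hc']; simp only [mul_assoc]
      _ = c * (s * b) * a := by rw [← h']
      _ = _ := by simp only [mul_assoc]
  obtain ⟨p, hp⟩ := r
  obtain ⟨q, hq⟩ := l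
  obtain ⟨w, hw, -⟩ := R a
  refine ⟨p * w * q, ?_⟩
  calc a = a * w * a := hw
    _ = (a * b * p) * w * (q * b * a) := by rw [← hp, ← hq]
    _ = _ := by simp only [mul_assoc]


theorem stmt_16 (S : Type*) [Semigroup S] :
    let leJ : S → S → Prop := fun a b =>
      a = b ∨ (∃ s : S, a = s * b) ∨ (∃ t : S, a = b * t) ∨ ∃ s t : S, a = s * b * t
    let J : S → S → Prop := fun a b => leJ a b ∧ leJ b a
    let CS : Prop := (∀ a : S, ∃ x : S, a = a * x * a ∧ a * x = x * a) ∧ ∀ a b : S, J a b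
    ((∀ a b : S, ∃ x : S, a = a * b * x * b * a) ↔ (∀ a b : S, ∃ x : S, a = a * b * x * a)) ∧
    ((∀ a b : S, ∃ x : S, a = a * b * x * a) ↔ (∀ a b : S, ∃ x : S, a = a * x * b * a)) ∧
    ((∀ a b : S, ∃ x : S, a = a * x * b * a) ↔ CS) := by

  intro leJ J CS
  have h12 : (∀ a b : S, ∃ x : S, a = a * b * x * b * a) → (∀ a b : S, ∃ x : S, a = a * b * x * a) :=
    fun H a b => (H a b).elim fun x hx => ⟨x * b, by simpa only [mul_assoc] using hx⟩
  have h13 : (∀ a b : S, ∃ x : S, a = a * b * x * b * a) → (∀ a b : S, ∃ x : S, a = a * x * b * a) :=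
    fun H a b => (H a b).elim fun x hx => ⟨b * x, by simpa only [mul_assoc] using hx⟩
  have h41 : CS → (∀ a b : S, ∃ x : S, a = a * b * x * b * a) :=
    fun H => aux_i H.1 fun a b => (H.2 a b).1
  have h24 : (∀ a b : S, ∃ x : S, a = a * b * x * a) → CS := by
    intro H
    have key : ∀ a b, leJ a b := fun a b =>
      (H a b).elim fun x hx => Or.inr (Or.inr (Or.inr ⟨a, x * a, by simpa only [mul_assoc] using hx⟩))
    exact ⟨fun a => aux_cr a (aux_ii H a), fun a b => ⟨key a b, key b a⟩⟩
  have h34 : (∀ a b : S, ∃ x : S, a = a * x * b * a) → CS := by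
    intro H
    have key : ∀ a b, leJ a b := fun a b =>
      (H a b).elim fun x hx => Or.inr (Or.inr (Or.inr ⟨a * x, a, hx⟩))
    exact ⟨fun a => aux_cr a (aux_iii H a), fun a b => ⟨key a b, key b a⟩⟩
  exact ⟨⟨h12, fun h => h41 (h24 h)⟩, ⟨fun h => h13 (h41 (h24 h)), fun h => h12 (h41 (h34 h))⟩,
    ⟨h34, fun h => h13 (h41 h)⟩⟩
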